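/- arXiv:2302.01332 — 2 statements merged into one kernel-verified Lean document; each statement's English description precedes it below -/
import Mathlib

section
/- Let κ > 0 and c_κ > 0 be constants, let Pos and Neg be disjoint finite sets of index pairs, and let z : ι → E assign unit vectors in a real inner product space to a finite index set ι. Define the dataset likelihood L = Π_{(i,j) ∈ Pos} c_κ exp(−κ‖z_i − z_j‖²/2) · Π_{(i,j) ∈ Neg} c_κ exp(−κ‖z_i + z_j‖²/2). Then log L = (|Pos| + |Neg|) · log c_κ − 2κ|Neg| − [ Σ_{(i,j) ∈ Pos} (κ/2)‖z_i − z_j‖² − Σ_{(i,j) ∈ Neg} (κ/2)‖z_i − z_j‖² ]. That is, the log-likelihood equals a constant depending only on κ (and the pair counts) minus the contrastive loss with targets κ on positive pairs and −κ on negative pairs. -/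
theorem log_prod_const_mul_exp {α : Type*} (s : Finset α) {c : ℝ} (hc : 0 < c) (f : α → ℝ) :
    Real.log (∏ a ∈ s, c * Real.exp (f a)) = (s.card : ℝ) * Real.log c + ∑ a ∈ s, f a := by
  rw [Real.log_prod fun a _ => (mul_pos hc (Real.exp_pos _)).ne']
  simp [Real.log_mul hc.ne' (Real.exp_ne_zero _), Finset.sum_add_distrib]

theorem norm_add_sq_eq_four_sub_of_norm_eq_one {E : Type*} [NormedAddCommGroup E]
    [InnerProductSpace ℝ E] {x y : E} (hx : ‖x‖ = 1) (hy : ‖y‖ = 1) :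
    ‖x + y‖ ^ 2 = 4 - ‖x - y‖ ^ 2 := by
  rw [norm_add_sq_real, norm_sub_sq_real, hx, hy]
  ring

/-- The log of the dataset likelihood (products of attractive and repulsive
von Mises–Fisher densities over positive and negative pairs of unit-norm
embeddings) equals a constant depending only on `κ` and the pair counts minus
the contrastive loss. -/
theorem contrastive_loss_is_neg_log_likelihood {ι E : Type*}
    [NormedAddCommGroup E] [InnerProductSpace ℝ E]
    (κ c : ℝ) (hκ : 0 < κ) (hc : 0 < c)
    (Pos Neg : Finset (ι × ι)) (hdisj : Disjoint Pos Neg)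
    (z : ι → E) (hz : ∀ i, ‖z i‖ = 1) :
    let L : ℝ :=
      (∏ p ∈ Pos, c * Real.exp (-(κ * ‖z p.1 - z p.2‖ ^ 2) / 2)) *
      (∏ p ∈ Neg, c * Real.exp (-(κ * ‖z p.1 + z p.2‖ ^ 2) / 2))
    Real.log L
      = ((Pos.card : ℝ) + (Neg.card : ℝ)) * Real.log c
        - 2 * κ * (Neg.card : ℝ)
        - ( ∑ p ∈ Pos, (κ / 2) * ‖z p.1 - z p.2‖ ^ 2
          - ∑ p ∈ Neg, (κ / 2) * ‖z p.1 - z p.2‖ ^ 2 ) := by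
  intro L
  have h_ne (s : Finset (ι × ι)) (f : ι × ι → ℝ) : ∏ p ∈ s, c * Real.exp (f p) ≠ 0 :=
    (Finset.prod_pos fun p _ => mul_pos hc (Real.exp_pos _)).ne'
  have h_pos : ∑ p ∈ Pos, -(κ * ‖z p.1 - z p.2‖ ^ 2) / 2
      = -∑ p ∈ Pos, (κ / 2) * ‖z p.1 - z p.2‖ ^ 2 := by
    rw [← Finset.sum_neg_distrib]
    exact Finset.sum_congr rfl fun p _ => by ring
  have h_neg : ∑ p ∈ Neg, -(κ * ‖z p.1 + z p.2‖ ^ 2) / 2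
      = ∑ p ∈ Neg, (κ / 2) * ‖z p.1 - z p.2‖ ^ 2 - 2 * κ * (Neg.card : ℝ) := by
    have h_const : 2 * κ * (Neg.card : ℝ) = ∑ _p ∈ Neg, 2 * κ := by
      rw [Finset.sum_const, nsmul_eq_mul, mul_comm]
    rw [h_const, ← Finset.sum_sub_distrib]
    refine Finset.sum_congr rfl fun p _ => ?_
    rw [norm_add_sq_eq_four_sub_of_norm_eq_one (hz p.1) (hz p.2)]
    ring
  rw [Real.log_mul (h_ne _ _) (h_ne _ _), log_prod_const_mul_exp _ hc,
    log_prod_const_mul_exp _ hc, h_pos, h_neg]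
  ring
end

section
/- Let E be a real inner product space, y ∈ ℝ, and z_1, z_2 ∈ E nonzero. Write ẑ_k = z_k/‖z_k‖. The map F(z_1, z_2) = y(1 − ⟨z_1/‖z_1‖, z_2/‖z_2‖⟩) is twice differentiable at (z_1, z_2), and its mixed second derivative in directions u (in the z_1 slot) and v (in the z_2 slot) equals (y/(‖z_1‖·‖z_2‖)) · ( −⟨u, v⟩ + ⟨ẑ_1, u⟩⟨ẑ_1, v⟩ + ⟨ẑ_2, u⟩⟨ẑ_2, v⟩ − ⟨ẑ_1, ẑ_2⟩·⟨ẑ_1, u⟩⟨ẑ_2, v⟩ ). -/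
open scoped RealInnerProductSpace

theorem hasFDerivAt_norm_inv_smul {E : Type*} [NormedAddCommGroup E] [InnerProductSpace ℝ E]
    {z : E} (hz : z ≠ 0) :
    HasFDerivAt (fun x : E => ‖x‖⁻¹ • x)
      (‖z‖⁻¹ • (ContinuousLinearMap.id ℝ E -
        (innerSL ℝ (‖z‖⁻¹ • z)).smulRight (‖z‖⁻¹ • z))) z := by
  have hn : ‖z‖ ≠ 0 := norm_ne_zero_iff.2 hz
  have hsq : HasFDerivAt (fun x : E => Real.sqrt (‖x‖ ^ 2))
      ((1 / (2 * Real.sqrt (‖z‖ ^ 2))) • (2 • innerSL ℝ z)) z :=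
    (hasStrictFDerivAt_norm_sq z).hasFDerivAt.sqrt (by positivity)
  simp only [Real.sqrt_sq (norm_nonneg _)] at hsq
  have hinv := ((hasDerivAt_inv hn).comp_hasFDerivAt z hsq).smul (hasFDerivAt_id z)
  refine hinv.congr_fderiv ?_
  ext u
  simp only [Function.comp_apply, id_eq, add_apply, smul_apply, sub_apply,
    ContinuousLinearMap.smulRight_apply, ContinuousLinearMap.id_apply, innerSL_apply_apply,
    real_inner_smul_left, smul_sub, smul_smul, nsmul_eq_mul, smul_eq_mul]
  rw [sub_eq_add_neg, ← neg_smul]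
  congr 2
  push_cast
  field_simp

/-- The Arccos per-pair contrastive loss
`F(z₁, z₂) = y(1 − ⟨z₁/‖z₁‖, z₂/‖z₂‖⟩)` is twice differentiable at a pair of
nonzero points, and its mixed second derivative in directions `u` (first slot)
and `v` (second slot) equals
`(y/(‖z₁‖‖z₂‖))(−⟨u,v⟩ + ⟨ẑ₁,u⟩⟨ẑ₁,v⟩ + ⟨ẑ₂,u⟩⟨ẑ₂,v⟩
 − ⟨ẑ₁,ẑ₂⟩⟨ẑ₁,u⟩⟨ẑ₂,v⟩)` where `ẑₖ = zₖ/‖zₖ‖`. -/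
theorem arccos_contrastive_mixed_second_derivative {E : Type*}
    [NormedAddCommGroup E] [InnerProductSpace ℝ E]
    (y : ℝ) (z₁ z₂ : E) (h₁ : z₁ ≠ 0) (h₂ : z₂ ≠ 0) :
    let F : E × E → ℝ := fun p =>
      y * (1 - ⟪‖p.1‖⁻¹ • p.1, ‖p.2‖⁻¹ • p.2⟫)
    ContDiffAt ℝ 2 F (z₁, z₂) ∧
    ∀ u v : E,
      fderiv ℝ (fun w : E => fderiv ℝ (fun x : E => F (x, w)) z₁ u) z₂ v
        = (y / (‖z₁‖ * ‖z₂‖)) *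
          ( -⟪u, v⟫
            + ⟪‖z₁‖⁻¹ • z₁, u⟫ * ⟪‖z₁‖⁻¹ • z₁, v⟫
            + ⟪‖z₂‖⁻¹ • z₂, u⟫ * ⟪‖z₂‖⁻¹ • z₂, v⟫
            - ⟪‖z₁‖⁻¹ • z₁, ‖z₂‖⁻¹ • z₂⟫ *
              (⟪‖z₁‖⁻¹ • z₁, u⟫ * ⟪‖z₂‖⁻¹ • z₂, v⟫) ) := by
  intro F
  constructor
  · have h1 : ‖z₁‖ ≠ 0 := norm_ne_zero_iff.2 h₁
    have h2 : ‖z₂‖ ≠ 0 := norm_ne_zero_iff.2 h₂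
    have hfst : ContDiffAt ℝ 2 (fun p : E × E => ‖p.1‖⁻¹ • p.1) (z₁, z₂) :=
      ((contDiffAt_fst.norm ℝ h₁).inv h1).smul contDiffAt_fst
    have hsnd : ContDiffAt ℝ 2 (fun p : E × E => ‖p.2‖⁻¹ • p.2) (z₁, z₂) :=
      ((contDiffAt_snd.norm ℝ h₂).inv h2).smul contDiffAt_snd
    exact contDiffAt_const.mul (contDiffAt_const.sub (hfst.inner ℝ hsnd))
  · intro u v
    have hfirst : ∀ w : E, fderiv ℝ (fun x : E => F (x, w)) z₁ u =
        y * -⟪‖z₁‖⁻¹ • (u - ⟪‖z₁‖⁻¹ • z₁, u⟫ • ‖z₁‖⁻¹ • z₁), ‖w‖⁻¹ • w⟫ := fun w => by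
      rw [((((hasFDerivAt_norm_inv_smul h₁).inner ℝ
        (hasFDerivAt_const (‖w‖⁻¹ • w) z₁)).const_sub 1).const_mul y).fderiv]
      simp [real_inner_smul_left]
    simp_rw [hfirst]
    rw [((((hasFDerivAt_const (‖z₁‖⁻¹ • (u - ⟪‖z₁‖⁻¹ • z₁, u⟫ • ‖z₁‖⁻¹ • z₁)) z₂).inner ℝ
      (hasFDerivAt_norm_inv_smul h₂)).fun_neg).const_mul y).fderiv]
    simp only [smul_apply, neg_apply,
      ContinuousLinearMap.comp_apply, ContinuousLinearMap.prod_apply, fderivInnerCLM_apply,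
      zero_apply, sub_apply,
      ContinuousLinearMap.smulRight_apply, ContinuousLinearMap.id_apply, innerSL_apply_apply,
      inner_zero_left, inner_sub_left, inner_sub_right, real_inner_smul_left,
      real_inner_smul_right, smul_eq_mul, real_inner_comm u z₂]
    ring
end
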